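/- arXiv:1209.3759 — 7 statements merged into one kernel-verified Lean document; each statement's English description precedes it below -/
import Mathlib

section
/- Let (E, ℱ) be a p-system (p ≥ 1) and let f : 2^E → ℝ be a monotone, normalized (f(∅) = 0), nonnegative submodular function with curvature κ ∈ [0,1]. Let S be the final set of any greedy sequence for (ℱ, f). Then for every W ∈ ℱ, f(W) ≤ (p + κ) · f(S); that is, the greedy algorithm is a 1/(p+κ)-approximation for maximizing f over ℱ. -/
/-- An independence system: a nonempty family of finite sets closed under subsets. -/
def IsIndepSystem {α : Type*} (ℱ : Set (Finset α)) : Prop :=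
  ℱ.Nonempty ∧ ∀ A ∈ ℱ, ∀ B : Finset α, B ⊆ A → B ∈ ℱ

/-- `B` is a basis of `A`: an inclusion-maximal member of `ℱ` contained in `A`. -/
def IsBasisOf {α : Type*} (ℱ : Set (Finset α)) (A B : Finset α) : Prop :=
  B ∈ ℱ ∧ B ⊆ A ∧ ∀ B' ∈ ℱ, B' ⊆ A → B ⊆ B' → B' = B

/-- `ℱ` is a `p`-system: any basis of `A` is at most `p` times larger than any other. -/
def IsPSystem {α : Type*} (ℱ : Set (Finset α)) (p : ℝ) : Prop :=
  ∀ A B₁ B₂ : Finset α, IsBasisOf ℱ A B₁ → IsBasisOf ℱ A B₂ →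
    (B₁.card : ℝ) ≤ p * (B₂.card : ℝ)

def Submodular {α : Type*} [DecidableEq α] (f : Finset α → ℝ) : Prop :=
  ∀ S T : Finset α, f (S ∪ T) + f (S ∩ T) ≤ f S + f T

def MonotoneFn {α : Type*} (f : Finset α → ℝ) : Prop :=
  ∀ S T : Finset α, S ⊆ T → f S ≤ f T

/-- `f` has curvature `κ`: every marginal gain is at least `(1-κ)` times the singleton value. -/
def HasCurvature {α : Type*} [DecidableEq α] (f : Finset α → ℝ) (κ : ℝ) : Prop :=
  ∀ (A : Finset α) (e : α), e ∉ A → (1 - κ) * f {e} ≤ f (insert e A) - f A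

/-- A greedy sequence for `(ℱ, f)`: distinct elements, all prefixes independent, each
element maximizes marginal gain among feasible additions, and the final set is maximal. -/
structure IsGreedySeq {α : Type*} [DecidableEq α] (ℱ : Set (Finset α)) (f : Finset α → ℝ)
    (l : List α) : Prop where
  nodup : l.Nodup
  indep : ∀ t : ℕ, (l.take t).toFinset ∈ ℱ
  greedy : ∀ (t : ℕ) (ht : t < l.length), ∀ e ∉ (l.take t).toFinset,
    insert e (l.take t).toFinset ∈ ℱ →
    f (insert e (l.take t).toFinset) - f (l.take t).toFinset ≤
      f (insert (l.get ⟨t, ht⟩) (l.take t).toFinset) - f (l.take t).toFinset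
  maximal : ∀ e ∉ l.toFinset, insert e l.toFinset ∉ ℱ

open Finset

section Submodular

variable {α : Type*} [DecidableEq α] {f : Finset α → ℝ}

theorem Submodular.marginal_anti (hsub : Submodular f) (hmono : MonotoneFn f)
    {A B : Finset α} (hAB : A ⊆ B) (e : α) :
    f (insert e B) - f B ≤ f (insert e A) - f A := by
  have h := hsub (insert e A) B
  have hunion : insert e A ∪ B = insert e B := by
    rw [insert_union, union_eq_right.mpr hAB]
  have hinter := hmono A (insert e A ∩ B) (subset_inter (subset_insert e A) hAB)
  rw [hunion] at h
  linarith

theorem Submodular.union_le_add_sum_marginal (hsub : Submodular f) (hmono : MonotoneFn f)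
    (S T : Finset α) :
    f (S ∪ T) ≤ f S + ∑ e ∈ T, (f (insert e S) - f S) := by
  induction T using Finset.induction_on with
  | empty => simp
  | insert e T he ih =>
    have h := hsub.marginal_anti hmono (subset_union_left : S ⊆ S ∪ T) e
    rw [union_insert, sum_insert he]
    linarith

theorem HasCurvature.add_sum_le_union {κ : ℝ} (hcurv : HasCurvature f κ)
    {W T : Finset α} (hWT : Disjoint W T) :
    f W + (1 - κ) * ∑ e ∈ T, f {e} ≤ f (W ∪ T) := by
  induction T using Finset.induction_on with
  | empty => simp
  | insert e T he ih =>
    rw [disjoint_insert_right] at hWT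
    have h := hcurv (W ∪ T) e (by simp [hWT.1, he])
    have := ih hWT.2
    rw [union_insert, sum_insert he, mul_add]
    linarith

end Submodular

/-- Abel summation bound: weights whose partial sums are dominated by those of a constant
`p` give at most `p` times the total of a nonnegative antitone sequence. -/
theorem sum_mul_sub_le_of_antitone {ρ c : ℕ → ℝ} {p : ℝ} (hρ : Antitone ρ)
    (hρ0 : ∀ i, 0 ≤ ρ i) (hc0 : c 0 = 0) (hc : ∀ i, c i ≤ p * i) (n : ℕ) :
    ∑ i ∈ range n, ρ i * (c (i + 1) - c i) ≤ p * ∑ i ∈ range n, ρ i := by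
  have key : ∑ i ∈ range n, ρ i * (c (i + 1) - c i)
      ≤ p * ∑ i ∈ range n, ρ i + ρ n * (c n - p * n) := by
    induction n with
    | zero => simp [hc0]
    | succ n ih =>
      have h := mul_le_mul_of_nonneg_right (hρ n.le_succ) (sub_nonneg.mpr (hc (n + 1)))
      rw [sum_range_succ, sum_range_succ]
      push_cast at h ⊢
      linarith
  have := mul_nonneg (hρ0 n) (sub_nonneg.mpr (hc n))
  linarith

theorem IsPSystem.card_le_of_isBasisOf {α : Type*} [Fintype α] {ℱ : Set (Finset α)} {p : ℝ}
    (hpsys : IsPSystem ℱ p) {A B C : Finset α} (hB : IsBasisOf ℱ A B) (hC : C ∈ ℱ)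
    (hCA : C ⊆ A) : (C.card : ℝ) ≤ p * B.card := by
  obtain ⟨D, hCD, hD⟩ :=
    (Set.toFinite {X : Finset α | X ∈ ℱ ∧ X ⊆ A}).exists_le_maximal ⟨hC, hCA⟩
  have hDA : IsBasisOf ℱ A D :=
    ⟨hD.prop.1, hD.prop.2, fun X hX hXA hDX => (hD.eq_of_le ⟨hX, hXA⟩ hDX).symm⟩
  calc (C.card : ℝ) ≤ D.card := by exact_mod_cast card_le_card hCD
    _ ≤ p * B.card := hpsys A D B hDA hB

theorem List.toFinset_take_succ {α : Type*} [DecidableEq α] {l : List α} {t : ℕ}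
    (ht : t < l.length) :
    (l.take (t + 1)).toFinset = insert l[t] (l.take t).toFinset := by
  rw [List.take_succ_eq_append_getElem ht, List.toFinset_append, union_comm]
  rfl

theorem List.toFinset_take_mono {α : Type*} [DecidableEq α] (l : List α) :
    Monotone fun t => (l.take t).toFinset := fun _ _ h x hx => by
  simp only [List.mem_toFinset] at hx ⊢
  exact (List.take_subset_take_left l h) hx

theorem List.Nodup.getElem_notMem_toFinset_take {α : Type*} [DecidableEq α] {l : List α}
    (hl : l.Nodup) {t : ℕ} (ht : t < l.length) : l[t] ∉ (l.take t).toFinset := by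
  rw [List.mem_toFinset, List.mem_take_iff_getElem]
  rintro ⟨i, hi, h⟩
  have := (hl.getElem_inj_iff).mp h
  omega

theorem List.le_idxOf_of_notMem_take {α : Type*} [DecidableEq α] {l : List α} {t : ℕ} {x : α}
    (hx : x ∉ (l.take t).toFinset) (ht : t ≤ l.length) : t ≤ l.idxOf x := by
  by_contra! h
  refine hx ?_
  rw [List.mem_toFinset, List.mem_take_iff_getElem]
  exact ⟨l.idxOf x, by omega, List.getElem_idxOf _⟩

section Greedy

variable {α : Type*} [DecidableEq α]

/-- The elements of `W` that can no longer be added after the first `t` greedy steps. -/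
noncomputable def blocked (ℱ : Set (Finset α)) (l : List α) (W : Finset α) (t : ℕ) : Finset α :=
  open Classical in
  W.filter fun e => e ∈ (l.take t).toFinset ∨ insert e (l.take t).toFinset ∉ ℱ

/-- The marginal gain of `e` at the moment it is picked in `l`, or with respect to all of `l`
if it is never picked. -/
def pickGain (f : Finset α → ℝ) (l : List α) (e : α) : ℝ :=
  f (insert e (l.take (l.idxOf e)).toFinset) - f (l.take (l.idxOf e)).toFinset

/-- The increase of `f` in step `t`. -/
def stepGain (f : Finset α → ℝ) (l : List α) (t : ℕ) : ℝ :=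
  f (l.take (t + 1)).toFinset - f (l.take t).toFinset

variable {ℱ : Set (Finset α)} {f : Finset α → ℝ} {l : List α} {W : Finset α}

theorem mem_blocked {t : ℕ} {e : α} : e ∈ blocked ℱ l W t ↔
    e ∈ W ∧ (e ∈ (l.take t).toFinset ∨ insert e (l.take t).toFinset ∉ ℱ) := by
  simp [blocked]

theorem blocked_mono (hsys : IsIndepSystem ℱ) : Monotone (blocked ℱ l W) := by
  intro s t hst e he
  rw [mem_blocked] at he ⊢
  have hsub := List.toFinset_take_mono l hst
  exact ⟨he.1, he.2.imp (fun h => hsub h)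
    fun h hmem => h (hsys.2 _ hmem _ (insert_subset_insert e hsub))⟩

theorem blocked_zero (hsys : IsIndepSystem ℱ) (hW : W ∈ ℱ) : blocked ℱ l W 0 = ∅ := by
  refine eq_empty_of_forall_notMem fun e he => ?_
  rw [mem_blocked] at he
  simpa [hsys.2 W hW {e} (singleton_subset_iff.mpr he.1)] using he.2

theorem IsGreedySeq.blocked_length (h : IsGreedySeq ℱ f l) : blocked ℱ l W l.length = W := by
  ext e
  rw [mem_blocked, List.take_length]
  exact and_iff_left (or_iff_not_imp_left.mpr (h.maximal e))

theorem IsGreedySeq.isBasisOf_take (h : IsGreedySeq ℱ f l) (hsys : IsIndepSystem ℱ) (t : ℕ) :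
    IsBasisOf ℱ ((l.take t).toFinset ∪ blocked ℱ l W t) (l.take t).toFinset := by
  refine ⟨h.indep t, subset_union_left, fun B hB hBA hSB => (hSB.antisymm fun e he => ?_).symm⟩
  by_contra hmem
  have hblocked := (mem_blocked.mp ((mem_union.mp (hBA he)).resolve_left hmem)).2
  exact hblocked.elim hmem fun hn => hn (hsys.2 B hB _ (insert_subset he hSB))

theorem IsGreedySeq.card_blocked_le [Fintype α] {p : ℝ} (h : IsGreedySeq ℱ f l)
    (hsys : IsIndepSystem ℱ) (hp : 0 ≤ p) (hpsys : IsPSystem ℱ p) (hW : W ∈ ℱ) (t : ℕ) :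
    ((blocked ℱ l W t).card : ℝ) ≤ p * t := by
  have hC : blocked ℱ l W t ∈ ℱ := hsys.2 W hW _ fun e he => (mem_blocked.mp he).1
  have hcard : ((l.take t).toFinset.card : ℝ) ≤ t := by
    exact_mod_cast (List.toFinset_card_le _).trans (List.length_take_le t l)
  exact (hpsys.card_le_of_isBasisOf (h.isBasisOf_take hsys t) hC subset_union_right).trans
    (mul_le_mul_of_nonneg_left hcard hp)

theorem stepGain_nonneg (hmono : MonotoneFn f) (t : ℕ) : 0 ≤ stepGain f l t :=
  sub_nonneg.mpr (hmono _ _ (List.toFinset_take_mono l t.le_succ))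

theorem IsGreedySeq.marginal_le_stepGain (h : IsGreedySeq ℱ f l) {t : ℕ} (ht : t < l.length)
    {e : α} (he : e ∉ (l.take t).toFinset) (hmem : insert e (l.take t).toFinset ∈ ℱ) :
    f (insert e (l.take t).toFinset) - f (l.take t).toFinset ≤ stepGain f l t := by
  rw [stepGain, List.toFinset_take_succ ht]
  exact h.greedy t ht e he hmem

theorem IsGreedySeq.antitone_stepGain (h : IsGreedySeq ℱ f l) (hsys : IsIndepSystem ℱ)
    (hsub : Submodular f) (hmono : MonotoneFn f) : Antitone (stepGain f l) := by
  refine antitone_nat_of_succ_le fun t => ?_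
  have hS := List.toFinset_take_mono l t.le_succ
  rcases lt_or_ge (t + 1) l.length with ht | ht
  · have hind := h.indep (t + 1 + 1)
    rw [List.toFinset_take_succ ht] at hind
    refine le_trans ?_ (h.marginal_le_stepGain (Nat.lt_of_succ_lt ht)
      (fun hmem => h.nodup.getElem_notMem_toFinset_take ht (hS hmem))
      (hsys.2 _ hind _ (insert_subset_insert _ hS)))
    rw [stepGain, List.toFinset_take_succ ht]
    exact hsub.marginal_anti hmono hS _
  · have hzero : stepGain f l (t + 1) = 0 := by
      rw [stepGain, List.take_of_length_le ht, List.take_of_length_le (by omega), sub_self]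
    exact hzero.trans_le (stepGain_nonneg hmono t)

theorem pickGain_nonneg (hmono : MonotoneFn f) (e : α) : 0 ≤ pickGain f l e :=
  sub_nonneg.mpr (hmono _ _ (subset_insert _ _))

theorem pickGain_le_singleton (hsub : Submodular f) (hmono : MonotoneFn f) (hnorm : f ∅ = 0)
    (e : α) : pickGain f l e ≤ f {e} := by
  simpa [hnorm, pickGain] using
    hsub.marginal_anti hmono (empty_subset (l.take (l.idxOf e)).toFinset) e

theorem pickGain_of_notMem {e : α} (he : e ∉ l.toFinset) :
    pickGain f l e = f (insert e l.toFinset) - f l.toFinset := by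
  rw [pickGain, List.idxOf_of_notMem (by simpa using he), List.take_length]

theorem sum_pickGain_take (hl : l.Nodup) (hnorm : f ∅ = 0) {t : ℕ} (ht : t ≤ l.length) :
    ∑ e ∈ (l.take t).toFinset, pickGain f l e = f (l.take t).toFinset := by
  induction t with
  | zero => simp [hnorm]
  | succ t ih =>
    rw [List.toFinset_take_succ ht, sum_insert (hl.getElem_notMem_toFinset_take ht),
      ih (Nat.le_of_succ_le ht), pickGain, hl.idxOf_getElem]
    ring

theorem sum_pickGain (hl : l.Nodup) (hnorm : f ∅ = 0) :
    ∑ e ∈ l.toFinset, pickGain f l e = f l.toFinset := by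
  simpa using sum_pickGain_take hl hnorm le_rfl

theorem sum_stepGain (hnorm : f ∅ = 0) :
    ∑ t ∈ range l.length, stepGain f l t = f l.toFinset := by
  simp [stepGain, -sum_sub_distrib, sum_range_sub (fun t => f (l.take t).toFinset), hnorm]

theorem IsGreedySeq.sum_pickGain_blocked_le (h : IsGreedySeq ℱ f l) (hsys : IsIndepSystem ℱ)
    (hsub : Submodular f) (hmono : MonotoneFn f) (hW : W ∈ ℱ) {t : ℕ} (ht : t ≤ l.length) :
    ∑ e ∈ blocked ℱ l W t, pickGain f l e ≤ ∑ i ∈ range t,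
      stepGain f l i * ((blocked ℱ l W (i + 1)).card - (blocked ℱ l W i).card) := by
  induction t with
  | zero => simp [blocked_zero hsys hW]
  | succ t ih =>
    have hC : blocked ℱ l W t ⊆ blocked ℱ l W (t + 1) := blocked_mono hsys t.le_succ
    have hnew : ∑ e ∈ blocked ℱ l W (t + 1) \ blocked ℱ l W t, pickGain f l e
        ≤ (blocked ℱ l W (t + 1) \ blocked ℱ l W t).card • stepGain f l t := by
      refine sum_le_card_nsmul _ _ _ fun e he => ?_
      rw [mem_sdiff, mem_blocked, mem_blocked] at he
      obtain ⟨⟨heW, -⟩, hfree⟩ := he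
      simp only [heW, true_and, not_or, not_not] at hfree
      exact (hsub.marginal_anti hmono (List.toFinset_take_mono l
        (List.le_idxOf_of_notMem_take hfree.1 (Nat.le_of_succ_le ht))) e).trans
        (h.marginal_le_stepGain ht hfree.1 hfree.2)
    rw [nsmul_eq_mul, cast_card_sdiff hC] at hnew
    rw [sum_range_succ, ← sum_sdiff hC, mul_comm (stepGain f l t)]
    linarith [ih (Nat.le_of_succ_le ht)]

theorem IsGreedySeq.sum_pickGain_le [Fintype α] {p : ℝ} (h : IsGreedySeq ℱ f l)
    (hsys : IsIndepSystem ℱ) (hp : 0 ≤ p) (hpsys : IsPSystem ℱ p) (hsub : Submodular f)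
    (hmono : MonotoneFn f) (hnorm : f ∅ = 0) (hW : W ∈ ℱ) :
    ∑ e ∈ W, pickGain f l e ≤ p * f l.toFinset := by
  have hle := h.sum_pickGain_blocked_le hsys hsub hmono hW le_rfl
  rw [h.blocked_length] at hle
  refine hle.trans ?_
  rw [← sum_stepGain hnorm]
  exact sum_mul_sub_le_of_antitone (c := fun t => ((blocked ℱ l W t).card : ℝ))
    (h.antitone_stepGain hsys hsub hmono) (stepGain_nonneg hmono)
    (by simp [blocked_zero hsys hW]) (h.card_blocked_le hsys hp hpsys hW) l.length

end Greedy

/-- Greedy is a `1/(p+κ)`-approximation for maximizing a monotone submodular function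
with curvature `κ` over a `p`-system. -/
theorem greedy_psystem_curvature_approx {α : Type*} [DecidableEq α] [Fintype α]
    (ℱ : Set (Finset α)) (f : Finset α → ℝ) (p κ : ℝ) (l : List α)
    (hsys : IsIndepSystem ℱ) (hp : 1 ≤ p) (hpsys : IsPSystem ℱ p)
    (hsub : Submodular f) (hmono : MonotoneFn f) (hnorm : f ∅ = 0)
    (hnonneg : ∀ S : Finset α, 0 ≤ f S)
    (hκ0 : 0 ≤ κ) (hκ1 : κ ≤ 1) (hcurv : HasCurvature f κ)
    (hgreedy : IsGreedySeq ℱ f l) :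
    ∀ W ∈ ℱ, f W ≤ (p + κ) * f l.toFinset := by
  intro W hW
  have hWsum := hgreedy.sum_pickGain_le hsys (zero_le_one.trans hp) hpsys hsub hmono hnorm hW
  have hSsum := sum_pickGain hgreedy.nodup hnorm
  have hupper := hsub.union_le_add_sum_marginal hmono l.toFinset (W \ l.toFinset)
  rw [union_sdiff_self_eq_union, ← sum_congr rfl fun e he =>
    pickGain_of_notMem (f := f) (mem_sdiff.mp he).2] at hupper
  have hlower := hcurv.add_sum_le_union (disjoint_sdiff : Disjoint W (l.toFinset \ W))
  rw [union_sdiff_self_eq_union, union_comm] at hlower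
  have hsingle := mul_le_mul_of_nonneg_left (sum_le_sum fun e (_ : e ∈ l.toFinset \ W) =>
    pickGain_le_singleton (l := l) hsub hmono hnorm e) (sub_nonneg.mpr hκ1)
  have hS := sum_inter_add_sum_sdiff l.toFinset W (pickGain f l)
  have hWS := sum_inter_add_sum_sdiff W l.toFinset (pickGain f l)
  rw [inter_comm] at hWS
  have hcommon : 0 ≤ κ * ∑ e ∈ l.toFinset ∩ W, pickGain f l e :=
    mul_nonneg hκ0 (sum_nonneg fun e _ => pickGain_nonneg hmono e)
  have hκS : κ * f l.toFinset = κ * ∑ e ∈ l.toFinset ∩ W, pickGain f l e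
      + κ * ∑ e ∈ l.toFinset \ W, pickGain f l e := by
    rw [← hSsum, ← hS, mul_add]
  linarith
end

section
/- The undirected TSP independence system on the complete graph K_n is 3-extendible: for every B ∈ ℱ, every A ⊆ B, and every edge x ∉ A with A ∪ {x} ∈ ℱ, there exists C ⊆ B \ A with |C| ≤ 3 such that (B \ C) ∪ {x} ∈ ℱ. -/
/-- Degree of a vertex in an edge set. -/
def degIn {V : Type*} [DecidableEq V] (S : Finset (Sym2 V)) (v : V) : ℕ :=
  (S.filter (fun e => v ∈ e)).card

/-- `S` is the edge set of a Hamiltonian cycle of the complete graph on `V`. -/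
def IsTour {V : Type*} [DecidableEq V] (S : Finset (Sym2 V)) : Prop :=
  ∃ (v : V) (w : (SimpleGraph.fromEdgeSet (S : Set (Sym2 V))).Walk v v),
    w.IsHamiltonianCycle ∧ S = w.edges.toFinset

/-- The undirected TSP independence system on the complete graph `K_n`:
edge sets of non-loop edges in which every vertex has degree at most `2` and which
contain no cycle, except that a Hamiltonian cycle is allowed. -/
def TSPIndep {V : Type*} [DecidableEq V] (S : Finset (Sym2 V)) : Prop :=
  (∀ e ∈ S, ¬ e.IsDiag) ∧ (∀ v : V, degIn S v ≤ 2) ∧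
  ((SimpleGraph.fromEdgeSet (S : Set (Sym2 V))).IsAcyclic ∨ IsTour S)

section Degree

variable {V : Type*} [DecidableEq V]

theorem degIn_mono {S T : Finset (Sym2 V)} (h : S ⊆ T) (v : V) : degIn S v ≤ degIn T v :=
  Finset.card_le_card (Finset.filter_subset_filter _ h)

theorem degIn_insert {S : Finset (Sym2 V)} {x : Sym2 V} (h : x ∉ S) {v : V} (hv : v ∈ x) :
    degIn (insert x S) v = degIn S v + 1 := by
  simp [degIn, Finset.filter_insert, hv, h]

theorem degIn_insert_of_notMem {S : Finset (Sym2 V)} {x : Sym2 V} {v : V} (hv : v ∉ x) :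
    degIn (insert x S) v = degIn S v := by
  simp [degIn, Finset.filter_insert, hv]

/-- If `v` has degree at most `2` in `B` and at most `1` in `A`, then deleting at most one edge
of `B \ A` brings the degree of `v` down to `1`. -/
theorem exists_sdiff_degIn_le_one {A B : Finset (Sym2 V)} {v : V}
    (hA : degIn A v ≤ 1) (hB : degIn B v ≤ 2) :
    ∃ C ⊆ B \ A, C.card ≤ 1 ∧ degIn (B \ C) v ≤ 1 := by
  by_cases h : degIn B v ≤ 1
  · exact ⟨∅, by simp, by simp, by simpa using h⟩
  obtain ⟨e, he, heA⟩ := Finset.exists_mem_notMem_of_card_lt_card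
    (show degIn A v < degIn B v by omega)
  obtain ⟨heB, hve⟩ := Finset.mem_filter.1 he
  have heA : e ∉ A := fun h => heA (Finset.mem_filter.2 ⟨h, hve⟩)
  refine ⟨{e}, by simp [heB, heA], by simp, ?_⟩
  have := degIn_insert (Finset.notMem_erase e B) hve
  rw [Finset.insert_erase heB] at this
  rw [Finset.sdiff_singleton_eq_erase]
  omega

end Degree

section Tour

variable {V : Type*} [DecidableEq V] {S : Finset (Sym2 V)}

theorem IsTour.not_isDiag (hS : IsTour S) {e : Sym2 V} (he : e ∈ S) : ¬ e.IsDiag := by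
  obtain ⟨v, w, hw, h⟩ := hS
  rw [h, List.mem_toFinset] at he
  exact SimpleGraph.not_isDiag_of_mem_edgeSet _ (w.edges_subset_edgeSet he)

theorem IsTour.card_eq [Fintype V] (hS : IsTour S) : S.card = Fintype.card V := by
  obtain ⟨v, w, hw, h⟩ := hS
  rw [← hw.length_eq, ← w.length_edges, ← List.toFinset_card_of_nodup hw.edges_nodup, ← h]

theorem IsTour.two_le_degIn (hS : IsTour S) (v : V) : 2 ≤ degIn S v := by
  obtain ⟨u, w, hw, h⟩ := hS
  have h2 := hw.isCycle.ncard_neighborSet_toSubgraph_eq_two (hw.mem_support v)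
  rw [← h2, degIn, ← Set.ncard_coe_finset]
  refine Set.ncard_le_ncard_of_injOn (fun a => s(v, a)) ?_ ?_ (Finset.finite_toSet _)
  · intro a ha
    have : s(v, a) ∈ w.edges := by
      rw [← SimpleGraph.Walk.mem_edges_toSubgraph]
      exact ha
    rw [Finset.mem_coe, Finset.mem_filter, h, List.mem_toFinset]
    exact ⟨this, Sym2.mem_mk_left _ _⟩
  · intro a _ b _ hab
    exact Sym2.congr_right.1 hab

/-- Deleting an edge from a tour leaves a spanning tree. -/
theorem IsTour.isTree_erase [Fintype V] (hS : IsTour S) {e : Sym2 V} (he : e ∈ S) :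
    (SimpleGraph.fromEdgeSet (S.erase e : Set (Sym2 V))).IsTree := by
  have hcard := hS.card_eq
  have hloop : ∀ f ∈ S, ¬ f.IsDiag := fun f => hS.not_isDiag
  obtain ⟨v, w, hw, h⟩ := hS
  have hew : e ∈ w.edges := by rwa [h, List.mem_toFinset] at he
  have hconn : (SimpleGraph.fromEdgeSet (S : Set (Sym2 V))).Connected :=
    SimpleGraph.IsHamiltonian.connected fun _ => ⟨v, w, hw⟩
  rw [SimpleGraph.isTree_iff_connected_and_card]
  constructor
  · have hbr := fun hb : SimpleGraph.IsBridge _ e => hb.notMem_edges_of_isCycle hw.isCycle hew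
    induction e with | h a b
    convert! hconn.connected_delete_edge_of_not_isBridge hbr using 1
    ext c d
    simp
  · have : (SimpleGraph.fromEdgeSet (S.erase e : Set (Sym2 V))).edgeSet
        = ((S.erase e : Finset (Sym2 V)) : Set (Sym2 V)) := by
      rw [SimpleGraph.edgeSet_fromEdgeSet]
      ext f
      simpa using fun hf _ => hloop f hf
    rw [this, Nat.card_coe_set_eq, Set.ncard_coe_finset, Finset.card_erase_add_one he, hcard,
      Nat.card_eq_fintype_card]

/-- If `A` completes to a tour by one edge `x`, so that only the ends of `x` have degree below `2`
in `A`, then a set of degree at most `2` containing `A` lies in that tour. -/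
theorem IsTour.subset_of_subset {A B : Finset (Sym2 V)} {x : Sym2 V}
    (hx : IsTour (insert x A)) (hAB : A ⊆ B) (hB : ∀ e ∈ B, ¬ e.IsDiag)
    (hdeg : ∀ v, degIn B v ≤ 2) :
    B ⊆ insert x A := by
  intro e he
  by_contra hne
  have heA : e ∉ A := fun h => hne (Finset.mem_insert_of_mem h)
  have key : ∀ v ∈ e, v ∈ x := by
    intro v hv
    by_contra hvx
    have h1 := hx.two_le_degIn v
    rw [degIn_insert_of_notMem hvx] at h1
    have h2 := degIn_mono (Finset.insert_subset he hAB) v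
    rw [degIn_insert heA hv] at h2
    have := hdeg v
    omega
  have hed := hB e he
  induction e with | h a b
  have : x = s(a, b) := (Sym2.mem_and_mem_iff (by simpa using hed)).1
    ⟨key a (Sym2.mem_mk_left _ _), key b (Sym2.mem_mk_right _ _)⟩
  exact hne (this ▸ Finset.mem_insert_self _ _)

end Tour

section Acyclic

variable {V : Type*} [DecidableEq V]

theorem fromEdgeSet_insert_eq_sup_edge (S : Finset (Sym2 V)) (u v : V) :
    SimpleGraph.fromEdgeSet ((insert s(u, v) S : Finset (Sym2 V)) : Set (Sym2 V)) =
      SimpleGraph.fromEdgeSet (S : Set (Sym2 V)) ⊔ SimpleGraph.edge u v := by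
  rw [Finset.coe_insert, Set.insert_eq, SimpleGraph.fromEdgeSet_union, sup_comm]
  rfl

/-- In a forest, two vertices not joined within `A` can be separated by deleting at most one edge
outside `A`. -/
theorem exists_sdiff_not_reachable {A B : Finset (Sym2 V)} {u v : V}
    (hB : (SimpleGraph.fromEdgeSet (B : Set (Sym2 V))).IsAcyclic)
    (hA : ¬ (SimpleGraph.fromEdgeSet (A : Set (Sym2 V))).Reachable u v) :
    ∃ C ⊆ B \ A, C.card ≤ 1 ∧
      ¬ (SimpleGraph.fromEdgeSet ((B \ C : Finset (Sym2 V)) : Set (Sym2 V))).Reachable u v := by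
  by_cases h : (SimpleGraph.fromEdgeSet (B : Set (Sym2 V))).Reachable u v
  swap
  · exact ⟨∅, by simp, by simp, by simpa using h⟩
  obtain ⟨p, hp⟩ := h.exists_isPath
  obtain ⟨e, hep, heA⟩ : ∃ e ∈ p.edges, e ∉ A := by
    by_contra! hall
    refine hA (p.transfer _ fun e he => ?_).reachable
    rw [SimpleGraph.edgeSet_fromEdgeSet]
    exact ⟨hall e he, SimpleGraph.not_isDiag_of_mem_edgeSet _ (p.edges_subset_edgeSet he)⟩
  have heB : e ∈ B := by
    have := p.edges_subset_edgeSet hep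
    rw [SimpleGraph.edgeSet_fromEdgeSet] at this
    exact this.1
  refine ⟨{e}, by simp [heB, heA], by simp, fun hr => ?_⟩
  obtain ⟨q, hq⟩ := hr.exists_isPath
  have hle : SimpleGraph.fromEdgeSet ((B \ {e} : Finset (Sym2 V)) : Set (Sym2 V)) ≤
      SimpleGraph.fromEdgeSet (B : Set (Sym2 V)) :=
    SimpleGraph.fromEdgeSet_mono (Finset.coe_subset.2 Finset.sdiff_subset)
  have hpq := congrArg Subtype.val
    ((hB.subsingleton_path u v).elim ⟨p, hp⟩ ⟨q.mapLe hle, hq.mapLe hle⟩)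
  have heq : e ∈ q.edges := by
    have : p = q.mapLe hle := hpq
    rwa [this, SimpleGraph.Walk.edges_mapLe_eq_edges] at hep
  have := q.edges_subset_edgeSet heq
  rw [SimpleGraph.edgeSet_fromEdgeSet] at this
  simpa using this.1

end Acyclic

/-- The undirected TSP independence system is 3-extendible. -/
theorem tsp_three_extendible {V : Type*} [Fintype V] [DecidableEq V]
    (B A : Finset (Sym2 V)) (x : Sym2 V)
    (hB : TSPIndep B) (hAB : A ⊆ B) (hx : ¬ x.IsDiag) (hxA : x ∉ A)
    (hAx : TSPIndep (insert x A)) :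
    ∃ C ⊆ B \ A, C.card ≤ 3 ∧ TSPIndep (insert x (B \ C)) := by
  by_cases hxB : x ∈ B
  · exact ⟨∅, by simp, by simp, by simpa [Finset.insert_eq_of_mem hxB] using hB⟩
  obtain ⟨hloop, hdeg, hB⟩ := hB
  obtain ⟨-, hdegA, hA | hA⟩ := id hAx
  swap
  · have hsub := hA.subset_of_subset hAB hloop hdeg
    rw [Finset.subset_insert_iff_of_notMem hxB] at hsub
    obtain rfl := hAB.antisymm hsub
    exact ⟨∅, by simp, by simp, by simpa using hAx⟩
  have hA1 : ∀ w ∈ x, degIn A w ≤ 1 := fun w hw => by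
    have := hdegA w
    rw [degIn_insert hxA hw] at this
    omega
  induction x with | h u v
  have huv : u ≠ v := by simpa using hx
  obtain ⟨C₁, hC₁, hc₁, hd₁⟩ :=
    exists_sdiff_degIn_le_one (hA1 u (Sym2.mem_mk_left _ _)) (hdeg u)
  obtain ⟨C₂, hC₂, hc₂, hd₂⟩ :=
    exists_sdiff_degIn_le_one (hA1 v (Sym2.mem_mk_right _ _)) (hdeg v)
  have hacyc : (SimpleGraph.fromEdgeSet
      ((B \ (C₁ ∪ C₂) : Finset (Sym2 V)) : Set (Sym2 V))).IsAcyclic := by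
    obtain hB | hB := hB
    · exact hB.anti (SimpleGraph.fromEdgeSet_mono (Finset.coe_subset.2 Finset.sdiff_subset))
    · have hne : C₁.Nonempty := by
        rw [Finset.nonempty_iff_ne_empty]
        rintro rfl
        have := hB.two_le_degIn u
        rw [Finset.sdiff_empty] at hd₁
        omega
      obtain ⟨e, he⟩ := hne
      refine (hB.isTree_erase (Finset.mem_sdiff.1 (hC₁ he)).1).isAcyclic.anti
        (SimpleGraph.fromEdgeSet_mono (Finset.coe_subset.2 ?_))
      rw [← Finset.sdiff_singleton_eq_erase]
      exact Finset.sdiff_subset_sdiff le_rfl (by simp [he])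
  have hnr : ¬ (SimpleGraph.fromEdgeSet (A : Set (Sym2 V))).Reachable u v := fun hr => by
    rw [fromEdgeSet_insert_eq_sup_edge, SimpleGraph.isAcyclic_sup_fromEdgeSet_iff] at hA
    simpa [huv, hxA] using hA.2 hr
  obtain ⟨C₃, hC₃, hc₃, hr₃⟩ := exists_sdiff_not_reachable hacyc hnr
  rw [sdiff_sdiff_left, Finset.sup_eq_union] at hr₃
  have hsub₁ : B \ (C₁ ∪ C₂ ∪ C₃) ⊆ B \ C₁ := Finset.sdiff_subset_sdiff le_rfl (by grind)
  have hsub₂ : B \ (C₁ ∪ C₂ ∪ C₃) ⊆ B \ C₂ := Finset.sdiff_subset_sdiff le_rfl (by grind)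
  have hx' : s(u, v) ∉ B \ (C₁ ∪ C₂ ∪ C₃) := fun h => hxB (Finset.mem_sdiff.1 h).1
  refine ⟨C₁ ∪ C₂ ∪ C₃, by grind, ?_, ?_, fun w => ?_, Or.inl ?_⟩
  · have := Finset.card_union_le (C₁ ∪ C₂) C₃
    have := Finset.card_union_le C₁ C₂
    omega
  · intro e he
    obtain rfl | he := Finset.mem_insert.1 he
    · exact hx
    · exact hloop e (Finset.mem_sdiff.1 he).1
  · by_cases hw : w ∈ s(u, v)
    · rw [degIn_insert hx' hw]
      obtain rfl | rfl := Sym2.mem_iff.1 hw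
      · have := degIn_mono hsub₁ w
        omega
      · have := degIn_mono hsub₂ w
        omega
    · rw [degIn_insert_of_notMem hw]
      exact (degIn_mono Finset.sdiff_subset w).trans (hdeg w)
  · rw [fromEdgeSet_insert_eq_sup_edge]
    exact (hacyc.anti (SimpleGraph.fromEdgeSet_mono (Finset.coe_subset.2
      (Finset.sdiff_subset_sdiff le_rfl (by grind))))).sup_edge_of_not_reachable hr₃
end

section
/- Let w : 2^E → ℝ≥0 be a monotone, normalized (w(∅) = 0) submodular function on the edge set E of the complete graph K_n, with independence-system curvature κ_I ∈ [0,1] with respect to the independence system of simple 2-matchings. Define the linear relaxation w̃(S) = Σ_{e ∈ S} w({e}). Let M₁ be a simple 2-matching maximizing w and let M₂ be a simple 2-matching maximizing w̃. Then w(M₂) ≥ (1 − κ_I) · w(M₁). -/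
/-- A simple 2-matching of the complete graph on `V`. -/
def Matching2 {V : Type*} [DecidableEq V] (S : Finset (Sym2 V)) : Prop :=
  (∀ e ∈ S, ¬ e.IsDiag) ∧ (∀ v : V, degIn S v ≤ 2)

/-- Independence-system curvature: the curvature condition is required only for
independent sets that remain independent after adding the element. -/
def HasIndepCurvature {α : Type*} [DecidableEq α] (ℱ : Set (Finset α))
    (f : Finset α → ℝ) (κ : ℝ) : Prop :=
  ∀ A ∈ ℱ, ∀ e ∉ A, insert e A ∈ ℱ → (1 - κ) * f {e} ≤ f (insert e A) - f A

/-- Simple 2-matchings are closed under subsets. -/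
theorem Matching2.subset {V : Type*} [DecidableEq V] {S T : Finset (Sym2 V)}
    (hT : Matching2 T) (hST : S ⊆ T) : Matching2 S :=
  ⟨fun e he => hT.1 e (hST he), fun v =>
    (Finset.card_le_card (Finset.filter_subset_filter _ hST)).trans (hT.2 v)⟩

/-- A normalized nonnegative submodular function is bounded by the sum of its singleton values. -/
theorem Submodular.le_sum_singleton {α : Type*} [DecidableEq α] {f : Finset α → ℝ}
    (hf : Submodular f) (hnonneg : ∀ S, 0 ≤ f S) (hnorm : f ∅ = 0) (S : Finset α) :
    f S ≤ ∑ e ∈ S, f {e} := by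
  induction S using Finset.induction_on with
  | empty => simp [hnorm]
  | insert a S ha ih =>
    have h := hf {a} S
    rw [← Finset.insert_eq] at h
    rw [Finset.sum_insert ha]
    linarith [hnonneg ({a} ∩ S)]

/-- On a member of a family closed under subsets, the curvature condition bounds a normalized
function below by `1 - κ` times the sum of its singleton values. -/
theorem HasIndepCurvature.sum_singleton_le {α : Type*} [DecidableEq α] {ℱ : Set (Finset α)}
    {f : Finset α → ℝ} {κ : ℝ} (hf : HasIndepCurvature ℱ f κ) (hℱ : IsLowerSet ℱ)
    (hnorm : f ∅ = 0) {S : Finset α} (hS : S ∈ ℱ) :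
    (1 - κ) * ∑ e ∈ S, f {e} ≤ f S := by
  induction S using Finset.induction_on with
  | empty => simp [hnorm]
  | insert a S ha ih =>
    have hS' : S ∈ ℱ := hℱ (Finset.subset_insert a S) hS
    rw [Finset.sum_insert ha, mul_add]
    linarith [ih hS', hf S hS' a ha hS]

/-- The maximum 2-matching for the linear relaxation `w̃(S) = Σ_{e∈S} w({e})` is within a
factor `1 − κ_I` of the maximum 2-matching for `w`. -/
theorem matching_linear_relaxation {V : Type*} [Fintype V] [DecidableEq V]
    (w : Finset (Sym2 V) → ℝ) (κI : ℝ) (M₁ M₂ : Finset (Sym2 V))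
    (hnonneg : ∀ S : Finset (Sym2 V), 0 ≤ w S)
    (hsub : Submodular w) (hmono : MonotoneFn w) (hnorm : w ∅ = 0)
    (hκ0 : 0 ≤ κI) (hκ1 : κI ≤ 1)
    (hcurv : HasIndepCurvature {S | Matching2 S} w κI)
    (hM₁ : Matching2 M₁)
    (hM₁max : ∀ M' : Finset (Sym2 V), Matching2 M' → w M' ≤ w M₁)
    (hM₂ : Matching2 M₂)
    (hM₂max : ∀ M' : Finset (Sym2 V), Matching2 M' →
      (∑ e ∈ M', w {e}) ≤ (∑ e ∈ M₂, w {e})) :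
    (1 - κI) * w M₁ ≤ w M₂ := by
  have hlower : IsLowerSet {S : Finset (Sym2 V) | Matching2 S} :=
    fun _ _ hST hT => Matching2.subset hT hST
  calc (1 - κI) * w M₁ ≤ (1 - κI) * ∑ e ∈ M₂, w {e} :=
        mul_le_mul_of_nonneg_left
          ((hsub.le_sum_singleton hnonneg hnorm M₁).trans (hM₂max M₁ hM₁)) (sub_nonneg.2 hκ1)
    _ ≤ w M₂ := hcurv.sum_singleton_le hlower hnorm hM₂
end

section
/- Let S be a finite set, let f : 2^S → ℝ≥0 be a monotone nonnegative submodular function, and let B₁, …, B_k (k ≥ 1) be pairwise disjoint subsets of S. Then Σ_{i=1}^{k} ( f(S) − f(S \ B_i) ) ≤ f(S). -/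
/-- Removing pairwise disjoint sets one after another, each removal costs at least the unique
contribution of the removed set. -/
theorem Submodular.sum_sub_sdiff_le {α ι : Type*} [DecidableEq α] {f : Finset α → ℝ}
    (hsub : Submodular f) (S : Finset α) (B : ι → Finset α)
    (hdisj : ∀ i j, i ≠ j → Disjoint (B i) (B j)) (t : Finset ι) :
    ∑ i ∈ t, (f S - f (S \ B i)) ≤ f S - f (S \ t.biUnion B) := by
  classical
  induction t using Finset.induction_on with
  | empty => simp
  | insert a t ha ih =>
    have hd : Disjoint (B a) (t.biUnion B) :=
      (Finset.disjoint_biUnion_right _ _ _).2 fun i hi =>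
        hdisj a i fun h => ha (h ▸ hi)
    have h := hsub (S \ B a) (S \ t.biUnion B)
    rw [← Finset.sdiff_inter_distrib_right, Finset.disjoint_iff_inter_eq_empty.1 hd,
      Finset.sdiff_empty, ← Finset.sdiff_union_distrib] at h
    rw [Finset.sum_insert ha, Finset.biUnion_insert]
    linarith

/-- For pairwise disjoint subsets `B₁, …, B_k` of `S`, the total of the unique
contributions `f(S) − f(S \ B_i)` is at most `f(S)`. -/
theorem sum_unique_contributions_le {α : Type*} [DecidableEq α]
    (S : Finset α) (f : Finset α → ℝ) (k : ℕ) (hk : 1 ≤ k) (B : Fin k → Finset α)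
    (hsub : Submodular f) (hmono : MonotoneFn f)
    (hnonneg : ∀ A : Finset α, 0 ≤ f A)
    (hBsub : ∀ i, B i ⊆ S)
    (hdisj : ∀ i j, i ≠ j → Disjoint (B i) (B j)) :
    ∑ i : Fin k, (f S - f (S \ B i)) ≤ f S := by
  have h := hsub.sum_sub_sdiff_le S B hdisj Finset.univ
  linarith [hnonneg (S \ Finset.univ.biUnion B)]
end

section
/- Let S be a finite set with |S| ≥ m·k (m ≥ 1, k ≥ 1), and let f : 2^S → ℝ≥0 be a monotone nonnegative submodular function. Then there exists a subset T ⊆ S with |T| = m such that f(S \ T) ≥ (1 − 1/k) · f(S). -/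
/-- If removing any `m`-element subset of `S` lowers a submodular `f` by more than `c`, then
removing any subset of size `m * (j + 1)` lowers it by more than `(j + 1) * c`. -/
theorem Submodular.sdiff_lt_sub_mul {α : Type*} [DecidableEq α] {f : Finset α → ℝ}
    (hsub : Submodular f) {S : Finset α} {m : ℕ} {c : ℝ}
    (h : ∀ T ⊆ S, T.card = m → f (S \ T) < f S - c) (j : ℕ) :
    ∀ U ⊆ S, U.card = m * (j + 1) → f (S \ U) < f S - (j + 1) * c := by
  induction j with
  | zero =>
    intro U hU hc
    simpa using h U hU (by simpa using hc)
  | succ j ih =>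
    intro U hU hc
    obtain ⟨T, hTU, hT⟩ := Finset.exists_subset_card_eq (s := U) (n := m) (by rw [hc]; nlinarith)
    have h₁ := h T (hTU.trans hU) hT
    have h₂ := ih (U \ T) (Finset.sdiff_subset.trans hU) (by
      rw [Finset.card_sdiff_of_subset hTU, hc, hT, mul_add_one m (j + 1), Nat.add_sub_cancel])
    have h₃ := hsub (S \ (U \ T)) (S \ T)
    have hunion : S \ (U \ T) ∪ S \ T = S := by grind
    have hinter : S \ (U \ T) ∩ (S \ T) = S \ U := by grind
    rw [hunion, hinter] at h₃
    push_cast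
    linarith

/-- If `|S| ≥ m·k`, then some `m`-element subset `T` can be removed from `S` while keeping
at least a `(1 − 1/k)` fraction of the value of a monotone nonnegative submodular `f`. -/
theorem exists_subset_removal {α : Type*} [DecidableEq α]
    (S : Finset α) (m k : ℕ) (hm : 1 ≤ m) (hk : 1 ≤ k)
    (hcard : m * k ≤ S.card)
    (f : Finset α → ℝ)
    (hsub : Submodular f) (hmono : MonotoneFn f)
    (hnonneg : ∀ X : Finset α, 0 ≤ f X) :
    ∃ T ⊆ S, T.card = m ∧ (1 - 1 / (k : ℝ)) * f S ≤ f (S \ T) := by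
  by_contra! hcon
  obtain ⟨j, rfl⟩ := Nat.exists_eq_add_of_le' hk
  obtain ⟨U, hU, hUc⟩ := Finset.exists_subset_card_eq hcard
  have hlt := hsub.sdiff_lt_sub_mul (c := f S / ((j + 1 : ℕ) : ℝ))
    (fun T hT hTc => (hcon T hT hTc).trans_eq (by ring)) j U hU hUc
  have hj : ((j : ℝ) + 1) ≠ 0 := by positivity
  rw [Nat.cast_add_one, mul_div_cancel₀ _ hj, sub_self] at hlt
  exact hlt.not_ge (hnonneg _)
end

section
/- Let M be an edge set of the complete graph K_n that is the disjoint union of the edge sets of m vertex-disjoint simple cycles T¹, …, Tᵐ, each containing at least 3 edges, together with at most one additional edge not in any of the cycles. Let w : 2^M → ℝ≥0 be a monotone nonnegative submodular function. Then there exists a set R ⊆ M containing exactly one edge from each cycle Tⁱ (and not containing the additional edge) such that w(M \ R) ≥ (2/3) · w(M). -/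
/-- `C` is the edge set of a simple cycle of the complete graph on `V`. -/
def IsCycleEdgeSet {V : Type*} [DecidableEq V] (C : Finset (Sym2 V)) : Prop :=
  ∃ (v : V) (w : (SimpleGraph.fromEdgeSet (C : Set (Sym2 V))).Walk v v),
    w.IsCycle ∧ C = w.edges.toFinset

/-- The set of vertices incident to an edge set. -/
def edgeVerts {V : Type*} [Fintype V] [DecidableEq V] (C : Finset (Sym2 V)) : Finset V :=
  Finset.univ.filter (fun v => ∃ e ∈ C, v ∈ e)

/-- Edge sets with disjoint vertex sets are disjoint. -/
theorem disjoint_of_disjoint_edgeVerts {V : Type*} [Fintype V] [DecidableEq V]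
    {C D : Finset (Sym2 V)} (h : Disjoint (edgeVerts C) (edgeVerts D)) : Disjoint C D := by
  rw [Finset.disjoint_left] at h ⊢
  intro e heC heD
  have hv : e.out.1 ∈ e := Sym2.out_fst_mem e
  refine h (a := e.out.1) ?_ ?_ <;> simp only [edgeVerts, Finset.mem_filter, Finset.mem_univ,
    true_and]
  exacts [⟨e, heC, hv⟩, ⟨e, heD, hv⟩]

/-- A nonnegative submodular function keeps two thirds of its value after removing one of any
three pairwise disjoint sets. -/
theorem exists_two_thirds_le_sdiff {α : Type*} [DecidableEq α] {M : Finset α} {w : Finset α → ℝ}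
    (hnonneg : ∀ A ⊆ M, 0 ≤ w A)
    (hsub : ∀ A B : Finset α, A ⊆ M → B ⊆ M → w (A ∪ B) + w (A ∩ B) ≤ w A + w B)
    (R : Fin 3 → Finset α) (hR : ∀ k l, k ≠ l → Disjoint (R k) (R l)) :
    ∃ k, (2 / 3 : ℝ) * w M ≤ w (M \ R k) := by
  have key : ∀ A B : Finset α, Disjoint A B →
      w M + w (M \ (A ∪ B)) ≤ w (M \ A) + w (M \ B) := by
    intro A B hAB
    have h := hsub (M \ A) (M \ B) Finset.sdiff_subset Finset.sdiff_subset
    rwa [← Finset.sdiff_union_distrib, ← Finset.sdiff_inter_distrib_right,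
      Finset.disjoint_iff_inter_eq_empty.mp hAB, Finset.sdiff_empty] at h
  have h₁ := key (R 0) (R 1) (hR 0 1 (by decide))
  have h₂ := key (R 0 ∪ R 1) (R 2)
    (Finset.disjoint_union_left.mpr ⟨hR 0 2 (by decide), hR 1 2 (by decide)⟩)
  have h₃ := hnonneg (M \ (R 0 ∪ R 1 ∪ R 2)) Finset.sdiff_subset
  by_contra! hlt
  linarith [hlt 0, hlt 1, hlt 2]

/-- From a disjoint union of `m` vertex-disjoint simple cycles (each with at least 3
edges) plus at most one extra edge, one edge can be removed from each cycle (leaving the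
extra edge) while keeping at least `2/3` of the value of a monotone nonnegative
submodular function. -/
theorem reduce_matching_two_thirds {V : Type*} [Fintype V] [DecidableEq V]
    (m : ℕ) (T : Fin m → Finset (Sym2 V)) (X M : Finset (Sym2 V))
    (w : Finset (Sym2 V) → ℝ)
    (hcycle : ∀ i, IsCycleEdgeSet (T i))
    (hsize : ∀ i, 3 ≤ (T i).card)
    (hvdisj : ∀ i j, i ≠ j → Disjoint (edgeVerts (T i)) (edgeVerts (T j)))
    (hXcard : X.card ≤ 1)
    (hXdisj : Disjoint X (Finset.univ.biUnion T))
    (hX : ∀ e ∈ X, ¬ e.IsDiag)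
    (hM : M = Finset.univ.biUnion T ∪ X)
    (hmono : ∀ A B : Finset (Sym2 V), A ⊆ B → B ⊆ M → w A ≤ w B)
    (hnonneg : ∀ A : Finset (Sym2 V), A ⊆ M → 0 ≤ w A)
    (hsub : ∀ A B : Finset (Sym2 V), A ⊆ M → B ⊆ M → w (A ∪ B) + w (A ∩ B) ≤ w A + w B) :
    ∃ R ⊆ M, (∀ i, (R ∩ T i).card = 1) ∧ Disjoint R X ∧
      (2 / 3 : ℝ) * w M ≤ w (M \ R) := by
  have hT : ∀ i j, i ≠ j → Disjoint (T i) (T j) := fun i j hij =>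
    disjoint_of_disjoint_edgeVerts (hvdisj i j hij)
  have hf : ∀ i, ∃ f : Fin 3 → Sym2 V, Function.Injective f ∧ ∀ k, f k ∈ T i := by
    intro i
    obtain ⟨g⟩ : Nonempty (Fin 3 ↪ T i) :=
      Function.Embedding.nonempty_of_card_le (by simpa using hsize i)
    exact ⟨fun k => g k, Subtype.val_injective.comp g.injective, fun k => (g k).2⟩
  choose f hinj hmem using hf
  have huniq : ∀ i j k, f i k ∈ T j → i = j := by
    intro i j k h
    by_contra hij
    exact Finset.disjoint_left.mp (hT i j hij) (hmem i k) h
  obtain ⟨k, hk⟩ := exists_two_thirds_le_sdiff hnonneg hsub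
    (fun k => Finset.univ.image fun i => f i k) (by
      intro k l hkl
      simp only [Finset.disjoint_left, Finset.mem_image, Finset.mem_univ, true_and]
      rintro _ ⟨i, rfl⟩ ⟨j, hj⟩
      obtain rfl := huniq j i l (hj ▸ hmem i k)
      exact hkl (hinj _ hj).symm)
  have hsubset : (Finset.univ.image fun i => f i k) ⊆ Finset.univ.biUnion T := by
    simp only [Finset.subset_iff, Finset.mem_image, Finset.mem_biUnion, Finset.mem_univ, true_and]
    rintro _ ⟨i, rfl⟩
    exact ⟨i, hmem i k⟩
  refine ⟨_, hM ▸ hsubset.trans Finset.subset_union_left, fun i => ?_,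
    (hXdisj.mono_right hsubset).symm, hk⟩
  rw [Finset.card_eq_one]
  refine ⟨f i k, ?_⟩
  ext e
  simp only [Finset.mem_inter, Finset.mem_image, Finset.mem_univ, true_and, Finset.mem_singleton]
  constructor
  · rintro ⟨⟨j, rfl⟩, he⟩
    rw [huniq j i k he]
  · rintro rfl
    exact ⟨⟨i, rfl⟩, hmem i k⟩
end

section
/- Let (E, ℱ) be a p-system (p ≥ 1), let f : 2^E → ℝ be a set function, let M ≥ 0, and define f'(X) = f(X) + |X|·M. Let n be the size of a maximum-cardinality basis of E. Suppose S, T, Z are bases of E (maximal members of ℱ), T maximizes f' over ℱ, Z maximizes f over ℱ, and S satisfies f'(S) ≥ α · f'(T) for some α with 0 ≤ α ≤ 1. Then f(S) ≥ α · f(Z) − M·n·( 1 + α(p − 2)/p ). -/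
/-- An `α`-approximation for the shifted function `f'(X) = f(X) + |X|·M` over a
`p`-system yields an additive-error approximation for `f` itself. -/
theorem shifted_approx_psystem {E : Type*} [DecidableEq E] [Fintype E]
    (ℱ : Set (Finset E)) (hsys : IsIndepSystem ℱ)
    (p : ℝ) (hp : 1 ≤ p) (hpsys : IsPSystem ℱ p)
    (f : Finset E → ℝ) (M : ℝ) (hM : 0 ≤ M)
    (f' : Finset E → ℝ) (hf' : ∀ X : Finset E, f' X = f X + (X.card : ℝ) * M)
    (n : ℕ)
    (hn_ex : ∃ B : Finset E, IsBasisOf ℱ Finset.univ B ∧ B.card = n)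
    (hn_max : ∀ B : Finset E, IsBasisOf ℱ Finset.univ B → B.card ≤ n)
    (S T Z : Finset E)
    (hS : IsBasisOf ℱ Finset.univ S) (hT : IsBasisOf ℱ Finset.univ T)
    (hZ : IsBasisOf ℱ Finset.univ Z)
    (hTmax : ∀ X ∈ ℱ, f' X ≤ f' T) (hZmax : ∀ X ∈ ℱ, f X ≤ f Z)
    (a : ℝ) (ha0 : 0 ≤ a) (ha1 : a ≤ 1) (hS_approx : a * f' T ≤ f' S) :
    a * f Z - M * (n : ℝ) * (1 + a * (p - 2) / p) ≤ f S := by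
  have hZT := mul_le_mul_of_nonneg_left (hTmax Z hZ.1) ha0
  rw [hf' Z] at hZT
  rw [hf' S] at hS_approx
  obtain ⟨B, hB, rfl⟩ := hn_ex
  have hp0 : 0 < p := by linarith
  have hS_card : (S.card : ℝ) * M ≤ B.card * M :=
    mul_le_mul_of_nonneg_right (Nat.cast_le.2 (hn_max S hS)) hM
  have hZ_card : (B.card : ℝ) / p ≤ Z.card := by
    rw [div_le_iff₀ hp0, mul_comm]
    exact hpsys _ _ _ hB hZ
  have hZ_shift : a * M * ((B.card : ℝ) / p) ≤ a * M * Z.card :=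
    mul_le_mul_of_nonneg_left hZ_card (mul_nonneg ha0 hM)
  have hdiv : (B.card : ℝ) / p ≤ B.card := div_le_self (Nat.cast_nonneg _) hp
  have hB_shift := mul_le_mul_of_nonneg_left hdiv (mul_nonneg ha0 hM)
  have hcoef : M * (B.card : ℝ) * (1 + a * (p - 2) / p) =
      M * B.card + a * M * B.card - 2 * (a * M * ((B.card : ℝ) / p)) := by
    field_simp
    ring
  rw [hcoef]
  linarith
end
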